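/- arXiv:2406.15682 — 2 statements merged into one kernel-verified Lean document; each statement's English description precedes it below -/
import Mathlib

section
/- Let M be the symmetric real block matrix M = [[M₁₁, M₁₂],[M₁₂', M₂₂]] with M₁₁ symmetric m×m, M₂₂ symmetric n×n, and M₁₂ an m×n matrix. Then M is positive semidefinite if and only if the following three conditions hold: M₁₁ ≥ 0, the Schur complement M₂₂ − M₁₂'M₁₁⁺M₁₂ ≥ 0, and R(M₁₂) ⊆ R(M₁₁). -/
open Matrix Set

noncomputable section

/-- `Ap` is the Moore–Penrose pseudoinverse of `A`. -/
def IsMoorePenrose {m n : ℕ} (A : Matrix (Fin m) (Fin n) ℝ)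
    (Ap : Matrix (Fin n) (Fin m) ℝ) : Prop :=
  A * Ap * A = A ∧ Ap * A * Ap = Ap ∧ (A * Ap)ᵀ = A * Ap ∧ (Ap * A)ᵀ = Ap * A

/-- Positive semidefinite partitioned matrices: `M = [[M₁₁, M₁₂],[M₁₂ᵀ, M₂₂]] ⪰ 0` iff
`M₁₁ ⪰ 0`, the Schur complement `M₂₂ − M₁₂ᵀM₁₁⁺M₁₂ ⪰ 0`, and `R(M₁₂) ⊆ R(M₁₁)`. -/
theorem stmt4 {m n : ℕ} (M11 : Matrix (Fin m) (Fin m) ℝ) (M12 : Matrix (Fin m) (Fin n) ℝ)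
    (M22 : Matrix (Fin n) (Fin n) ℝ) (h11sym : M11ᵀ = M11) (h22sym : M22ᵀ = M22)
    (M11p : Matrix (Fin m) (Fin m) ℝ) (hM11p : IsMoorePenrose M11 M11p) :
    (Matrix.fromBlocks M11 M12 M12ᵀ M22).PosSemidef ↔
      M11.PosSemidef ∧ (M22 - M12ᵀ * M11p * M12).PosSemidef ∧
        (∀ y : Fin n → ℝ, M12.mulVec y ∈ Set.range M11.mulVec) := by
  obtain ⟨h1, h2, h3, h4⟩ := hM11p
  rw [transpose_mul, h11sym] at h3 h4
  -- h3 : M11pᵀ * M11 = M11 * M11p, h4 : M11 * M11pᵀ = M11p * M11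
  have hcomm : M11 * M11p = M11p * M11 := by
    calc M11 * M11p = M11pᵀ * (M11 * M11p * M11) := by rw [h1, h3]
      _ = M11pᵀ * M11 * (M11p * M11) := by simp only [Matrix.mul_assoc]
      _ = M11pᵀ * M11 * (M11 * M11pᵀ) := by rw [h4]
      _ = (M11 * M11p * M11) * M11pᵀ := by rw [h3]; simp only [Matrix.mul_assoc]
      _ = M11p * M11 := by rw [h1, h4]
  have hP : M11pᵀ = M11p := by
    calc M11pᵀ = (M11p * M11 * M11p)ᵀ := by rw [h2]
      _ = M11pᵀ * M11 * M11pᵀ := by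
        rw [transpose_mul, transpose_mul, h11sym, Matrix.mul_assoc]
      _ = M11p * (M11 * M11pᵀ) := by rw [h3, hcomm, Matrix.mul_assoc]
      _ = M11p * M11 * M11p := by rw [h4, Matrix.mul_assoc, hcomm]
      _ = M11p := h2
  have hBP : ∀ X : Matrix (Fin m) (Fin n) ℝ, M11p * (M11 * (M11p * X)) = M11p * X := by
    intro X
    rw [← Matrix.mul_assoc, ← Matrix.mul_assoc, h2]
  constructor
  · intro h
    have hA : M11.PosSemidef := by
      exact h.submatrix (Sum.inl : Fin m → Fin m ⊕ Fin n)
    refine ⟨hA, ?_, ?_⟩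
    · have := h.conjTranspose_mul_mul_same (fromRows (-(M11p * M12)) 1)
      convert this using 1
      rw [conjTranspose_eq_transpose_of_trivial, transpose_fromRows,
        Matrix.mul_assoc (fromCols _ _), fromBlocks_mul_fromRows, fromCols_mul_fromRows]
      simp only [transpose_neg, transpose_mul, hP, Matrix.mul_neg, Matrix.neg_mul, Matrix.mul_add,
        Matrix.mul_assoc, hBP, transpose_one, Matrix.one_mul, Matrix.mul_one]
      abel
    · have key : M12ᵀ * (1 - M11p * M11) = 0 := by
        apply Matrix.ext_of_mulVec_single
        intro i
        generalize (Pi.single i 1 : Fin m → ℝ) = v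
        have hz : M11 *ᵥ ((1 - M11p * M11) *ᵥ v) = 0 := by
          rw [mulVec_mulVec, Matrix.mul_sub, ← Matrix.mul_assoc, h1]
          simp
        have h0 := (h.dotProduct_mulVec_zero_iff
          (Sum.elim ((1 - M11p * M11) *ᵥ v) 0)).1 (by
            rw [fromBlocks_mulVec]
            simp [hz, dotProduct])
        rw [fromBlocks_mulVec] at h0
        ext j
        have := congrFun h0 (Sum.inr j)
        simpa [mulVec_mulVec] using this
      have key2 : M11 * (M11p * M12) = M12 := by
        have := congrArg transpose key
        simp only [transpose_mul, transpose_sub, transpose_one, hP, h11sym, transpose_transpose,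
          transpose_zero, Matrix.sub_mul, Matrix.one_mul, Matrix.mul_assoc] at this
        exact (sub_eq_zero.1 this).symm
      intro y
      exact ⟨(M11p * M12) *ᵥ y, by simp only [mulVec_mulVec, key2]⟩
  · rintro ⟨hA, hS, hR⟩
    have hB : M11 * (M11p * M12) = M12 := by
      apply Matrix.ext_of_mulVec_single
      intro i
      obtain ⟨z, hz⟩ := hR (Pi.single i 1)
      rw [← mulVec_mulVec, ← mulVec_mulVec, ← hz, mulVec_mulVec, mulVec_mulVec,
        h1]
    have hBt : M12ᵀ * (M11p * M11) = M12ᵀ := by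
      have := congrArg transpose hB
      simpa only [transpose_mul, hP, h11sym, Matrix.mul_assoc] using this
    have e := (hA.conjTranspose_mul_mul_same (fromCols 1 (M11p * M12))).add
      (hS.conjTranspose_mul_mul_same (fromCols (0 : Matrix (Fin n) (Fin m) ℝ) 1))
    convert e using 1
    simp only [conjTranspose_eq_transpose_of_trivial, transpose_fromCols, Matrix.mul_assoc,
      fromRows_mul, mul_fromCols, transpose_mul, hP]
    ext (i | i) (j | j) <;> simp [Matrix.mul_assoc, hB, hBt]
end
end

section
/- Let V(u,w) = (1/2)(u,w)'M(u,w) + (u,w)'d with block matrix M = [[M₁₁, M₁₂],[M₁₂', M₂₂]], where M₁₁ ∈ ℝ^{m×m} is positive semidefinite, M₂₂ ∈ ℝ^{n×n} is negative semidefinite, M₁₂ ∈ ℝ^{m×n}, and d = (d₁,d₂) ∈ ℝ^{m+n}. Then a solution to min_u max_w V(u,w) (over u ∈ ℝ^m, w ∈ ℝ^n) exists if and only if d ∈ R(M), and likewise a solution to max_w min_u V(u,w) exists if and only if d ∈ R(M). -/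
open Matrix Set

noncomputable section

/-- `v` is the optimal value of `min_u max_w f u w`, i.e. for some `u` the inner supremum
over `w` is attained, and the infimum over `u` of the attained inner optimal values is
itself attained, with value `v`. -/
def MinMaxValue {α β : Type*} (f : α → β → ℝ) (v : ℝ) : Prop :=
  IsLeast {r | ∃ u, IsGreatest {s | ∃ w, s = f u w} r} v

/-- `v` is the optimal value of `max_w min_u f u w`. -/
def MaxMinValue {α β : Type*} (f : α → β → ℝ) (v : ℝ) : Prop :=
  IsGreatest {r | ∃ w, IsLeast {s | ∃ u, s = f u w} r} v

theorem aux_range {ι : Type*} [Fintype ι] [DecidableEq ι] (M : Matrix ι ι ℝ) (hM : Mᵀ = M)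
    (d : ι → ℝ) (h : ∀ k, M *ᵥ k = 0 → k ⬝ᵥ d = 0) : d ∈ Set.range M.mulVec := by
  by_contra hd
  have hd' : d ∉ LinearMap.range M.mulVecLin := by
    rintro ⟨x, hx⟩
    exact hd ⟨x, by simpa using hx⟩
  obtain ⟨f, hf, hle⟩ := Submodule.exists_le_ker_of_notMem hd'
  have hfk : ∀ x, f x = (fun i => f (Pi.single i 1)) ⬝ᵥ x := by
    intro x
    conv_lhs => rw [LinearMap.pi_apply_eq_sum_univ f x]
    simp only [dotProduct, smul_eq_mul]
    refine Finset.sum_congr rfl fun i _ => ?_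
    rw [mul_comm]
    congr 2
    ext j
    simp [Pi.single_apply, eq_comm]
  apply hf
  rw [hfk]
  apply h
  set k := (fun i => f (Pi.single i 1)) with hk
  apply dotProduct_eq_zero _
  intro x
  have h0 : f (M *ᵥ x) = 0 := by
    have := hle (x := M *ᵥ x) ⟨x, by simp⟩
    simpa using this
  rw [hfk, dotProduct_mulVec, ← mulVec_transpose, hM] at h0
  exact h0

theorem aux_shift {ι : Type*} [Fintype ι] (M : Matrix ι ι ℝ) (hM : Mᵀ = M)
    (d z k : ι → ℝ) :
    (1/2) * ((z + k) ⬝ᵥ M *ᵥ (z + k)) + (z + k) ⬝ᵥ d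
      = ((1/2) * (z ⬝ᵥ M *ᵥ z) + z ⬝ᵥ d) + k ⬝ᵥ (M *ᵥ z + d) + (1/2) * (k ⬝ᵥ M *ᵥ k) := by
  have h : z ⬝ᵥ M *ᵥ k = k ⬝ᵥ M *ᵥ z := by
    rw [dotProduct_mulVec, ← mulVec_transpose, hM, dotProduct_comm]
  simp only [mulVec_add, add_dotProduct, dotProduct_add, h]
  ring

/-- For `V(u,w) = (1/2)(u,w)'M(u,w) + (u,w)'d` with `M₁₁ ⪰ 0` and `M₂₂ ⪯ 0`, a solution
to `min_u max_w V` exists iff `d ∈ R(M)`, and a solution to `max_w min_u V` exists iff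
`d ∈ R(M)`. -/
theorem stmt7 {m n : ℕ} (M11 : Matrix (Fin m) (Fin m) ℝ) (M12 : Matrix (Fin m) (Fin n) ℝ)
    (M22 : Matrix (Fin n) (Fin n) ℝ)
    (h11 : M11.PosSemidef) (h22 : (-M22).PosSemidef)
    (d : Fin m ⊕ Fin n → ℝ) :
    let M := Matrix.fromBlocks M11 M12 M12ᵀ M22
    let V : (Fin m → ℝ) → (Fin n → ℝ) → ℝ := fun u w =>
      (1/2) * (Sum.elim u w ⬝ᵥ M.mulVec (Sum.elim u w)) + Sum.elim u w ⬝ᵥ d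
    ((∃ v, MinMaxValue V v) ↔ d ∈ Set.range M.mulVec) ∧
    ((∃ v, MaxMinValue V v) ↔ d ∈ Set.range M.mulVec) := by
  intro M V
  have hM : Mᵀ = M := by
    have e1 : M11ᵀ = M11 := by simpa using h11.isHermitian.eq
    have e2 : M22ᵀ = M22 := by
      have := h22.isHermitian.eq
      simpa using this
    simp [M, fromBlocks_transpose, e1, e2]
  have hV : ∀ u w h k, V (u + h) (w + k) = V u w
      + Sum.elim h k ⬝ᵥ (M *ᵥ Sum.elim u w + d)
      + (1/2) * (Sum.elim h k ⬝ᵥ M *ᵥ Sum.elim h k) := by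
    intro u w h k
    have e : Sum.elim (u + h) (w + k) = Sum.elim u w + Sum.elim h k := by
      ext i; cases i <;> simp
    simp only [V, e]
    exact aux_shift M hM d _ _
  have hker : ∀ u w h k, M *ᵥ Sum.elim h k = 0 →
      V (u + h) (w + k) = V u w + Sum.elim h k ⬝ᵥ d := by
    intro u w h k hk
    have e : Sum.elim h k ⬝ᵥ M *ᵥ Sum.elim u w = 0 := by
      rw [dotProduct_mulVec, ← mulVec_transpose, hM, hk, zero_dotProduct]
    rw [hV, hk, dotProduct_add, e]
    simp
  have hsad : d ∈ Set.range M.mulVec → ∃ u0 w0, (∀ w, V u0 w ≤ V u0 w0) ∧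
      (∀ u, V u0 w0 ≤ V u w0) := by
    rintro ⟨x, hx⟩
    have hz : M *ᵥ Sum.elim (fun i => -x (Sum.inl i)) (fun i => -x (Sum.inr i)) + d = 0 := by
      have : Sum.elim (fun i => -x (Sum.inl i)) (fun i => -x (Sum.inr i)) = -x := by
        ext i; cases i <;> simp
      rw [this, mulVec_neg, ← hx]
      simp
    refine ⟨fun i => -x (Sum.inl i), fun i => -x (Sum.inr i), ?_, ?_⟩
    · intro w
      have h1 := hV (fun i => -x (Sum.inl i)) (fun i => -x (Sum.inr i)) 0
        (w - fun i => -x (Sum.inr i))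
      have h2 := h22.dotProduct_mulVec_nonneg (w - fun i => -x (Sum.inr i))
      rw [hz, add_zero, add_sub_cancel, dotProduct_zero] at h1
      simp only [M, fromBlocks_mulVec, sumElim_dotProduct_sumElim, Sum.elim_comp_inl,
        Sum.elim_comp_inr, mulVec_zero, zero_dotProduct, zero_add] at h1
      simp only [star_trivial, neg_mulVec, dotProduct_neg] at h2
      linarith
    · intro u
      have h1 := hV (fun i => -x (Sum.inl i)) (fun i => -x (Sum.inr i))
        (u - fun i => -x (Sum.inl i)) 0
      have h2 := h11.dotProduct_mulVec_nonneg (u - fun i => -x (Sum.inl i))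
      rw [hz, add_zero, add_sub_cancel, dotProduct_zero] at h1
      simp only [M, fromBlocks_mulVec, sumElim_dotProduct_sumElim, Sum.elim_comp_inl,
        Sum.elim_comp_inr, mulVec_zero, zero_dotProduct, add_zero] at h1
      simp only [star_trivial] at h2
      linarith
  have hsplit : ∀ k : Fin m ⊕ Fin n → ℝ,
      Sum.elim (fun i => k (Sum.inl i)) (fun i => k (Sum.inr i)) = k := by
    intro k; ext i; cases i <;> rfl
  refine ⟨⟨?_, ?_⟩, ⟨?_, ?_⟩⟩
  · rintro ⟨v, ⟨u, ⟨w, hw⟩, hub⟩, hlb⟩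
    have key : ∀ k, M *ᵥ k = 0 → 0 ≤ k ⬝ᵥ d := by
      intro k hk
      rw [← hsplit k] at hk ⊢
      generalize (fun i => k (Sum.inl i)) = a at *
      generalize (fun i => k (Sum.inr i)) = b at *
      have := hlb (a := v + Sum.elim a b ⬝ᵥ d) ⟨u + a, ⟨w + b, by rw [hker _ _ _ _ hk, hw]⟩, by
        rintro s ⟨w', rfl⟩
        have e := hker u (w' - b) a b hk
        rw [sub_add_cancel] at e
        have := hub (a := V u (w' - b)) ⟨_, rfl⟩
        linarith⟩
      linarith
    apply aux_range M hM
    intro k hk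
    have h1 := key k hk
    have h2 := key (-k) (by rw [mulVec_neg, hk, neg_zero])
    rw [neg_dotProduct] at h2
    linarith
  · intro hd
    obtain ⟨u0, w0, h1, h2⟩ := hsad hd
    refine ⟨V u0 w0, ⟨u0, ⟨w0, rfl⟩, ?_⟩, ?_⟩
    · rintro s ⟨w, rfl⟩
      exact h1 w
    · rintro r ⟨u, -, hr⟩
      exact (h2 u).trans (hr ⟨w0, rfl⟩)
  · rintro ⟨v, ⟨w, ⟨u, hu⟩, hlb⟩, hub⟩
    have key : ∀ k, M *ᵥ k = 0 → k ⬝ᵥ d ≤ 0 := by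
      intro k hk
      rw [← hsplit k] at hk ⊢
      generalize (fun i => k (Sum.inl i)) = a at *
      generalize (fun i => k (Sum.inr i)) = b at *
      have := hub (a := v + Sum.elim a b ⬝ᵥ d) ⟨w + b, ⟨u + a, by rw [hker _ _ _ _ hk, hu]⟩, by
        rintro s ⟨u', rfl⟩
        have e := hker (u' - a) w a b hk
        rw [sub_add_cancel] at e
        have := hlb (a := V (u' - a) w) ⟨_, rfl⟩
        linarith⟩
      linarith
    apply aux_range M hM
    intro k hk
    have h1 := key k hk
    have h2 := key (-k) (by rw [mulVec_neg, hk, neg_zero])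
    rw [neg_dotProduct] at h2
    linarith
  · intro hd
    obtain ⟨u0, w0, h1, h2⟩ := hsad hd
    refine ⟨V u0 w0, ⟨w0, ⟨u0, rfl⟩, ?_⟩, ?_⟩
    · rintro s ⟨u, rfl⟩
      exact h2 u
    · rintro r ⟨w, -, hr⟩
      exact (hr ⟨u0, rfl⟩).trans (h1 w)
end
end
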